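/- Let R : ℕ⁵ → ℕ satisfy, for all x,y,z,a,c ∈ ℕ and i ∈ {0,1}: R(0,0,0,a,c) = 2c + bit_0(a); R(x,y,2z+i,a,c) = R(x,y,z, ⌊a/2^{2^{|x|·|y|+|z|}}⌋, R(x,y,z,a,c)) whenever 2z+i ≠ 0; R(x,2y+i,0,a,c) = R(x,y,x,a,c) whenever 2y+i ≠ 0; and R(2x+i,0,0,a,c) = R(x,0,0,a,c) whenever 2x+i ≠ 0. Then for all x,y,z,a,c ∈ ℕ, with N = 2^{|x|·|y|+|z|}: R(x,y,z,a,c) = c·2^N + rev_N(a). -/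

import Mathlib

/-- `bit j a` is the `j`-th binary digit of `a`. -/
def bit (j a : ℕ) : ℕ := a / 2 ^ j % 2

/-- `rev n a` : the `n` low-order binary digits of `a`, written in reverse order. -/
def rev (n a : ℕ) : ℕ := ∑ j ∈ Finset.range n, bit j a * 2 ^ (n - 1 - j)

theorem Nat.size_two_mul_add {z i : ℕ} (hi : i ≤ 1) (h : 2 * z + i ≠ 0) :
    Nat.size (2 * z + i) = Nat.size z + 1 := by
  obtain rfl | rfl : i = 0 ∨ i = 1 := by omega
  · simpa [Nat.bit] using Nat.size_bit (b := false) (n := z) (by simpa [Nat.bit] using h)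
  · simpa [Nat.bit] using Nat.size_bit (b := true) (n := z) (by simp [Nat.bit])

/-- Induction on the binary expansion of a natural number. -/
theorem Nat.binary_induction {p : ℕ → Prop} (zero : p 0)
    (step : ∀ z i, i ≤ 1 → 2 * z + i ≠ 0 → p z → p (2 * z + i)) (n : ℕ) : p n := by
  induction n using Nat.strong_induction_on with
  | _ n ih =>
    rcases Nat.eq_zero_or_pos n with rfl | hn
    · exact zero
    · have := step (n / 2) (n % 2) (by omega) (by omega) (ih _ (by omega))
      rwa [Nat.div_add_mod] at this

theorem bit_add (m j a : ℕ) : bit (m + j) a = bit j (a / 2 ^ m) := by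
  simp only [bit, pow_add, Nat.div_div_eq_div_mul]

theorem rev_add (m n a : ℕ) : rev (m + n) a = rev m a * 2 ^ n + rev n (a / 2 ^ m) := by
  simp only [rev, Finset.sum_range_add, Finset.sum_mul]
  congr 1
  · refine Finset.sum_congr rfl fun j hj => ?_
    have hj := Finset.mem_range.1 hj
    rw [mul_assoc, ← pow_add]
    congr 2
    omega
  · refine Finset.sum_congr rfl fun j _ => ?_
    rw [bit_add]
    congr 2
    omega

theorem stmt16 (R : ℕ → ℕ → ℕ → ℕ → ℕ → ℕ)
    (h0 : ∀ a c, R 0 0 0 a c = 2 * c + bit 0 a)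
    (h1 : ∀ x y z a c i, i ≤ 1 → 2 * z + i ≠ 0 →
      R x y (2 * z + i) a c =
        R x y z (a / 2 ^ 2 ^ (Nat.size x * Nat.size y + Nat.size z)) (R x y z a c))
    (h2 : ∀ x y a c i, i ≤ 1 → 2 * y + i ≠ 0 →
      R x (2 * y + i) 0 a c = R x y x a c)
    (h3 : ∀ x a c i, i ≤ 1 → 2 * x + i ≠ 0 →
      R (2 * x + i) 0 0 a c = R x 0 0 a c) :
    ∀ x y z a c, R x y z a c =
      c * 2 ^ 2 ^ (Nat.size x * Nat.size y + Nat.size z) +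
        rev (2 ^ (Nat.size x * Nat.size y + Nat.size z)) a := by
  have of_zero : ∀ x y, (∀ a c, R x y 0 a c =
      c * 2 ^ 2 ^ (Nat.size x * Nat.size y) + rev (2 ^ (Nat.size x * Nat.size y)) a) →
      ∀ z a c, R x y z a c = c * 2 ^ 2 ^ (Nat.size x * Nat.size y + Nat.size z) +
        rev (2 ^ (Nat.size x * Nat.size y + Nat.size z)) a := by
    intro x y hz z
    induction z using Nat.binary_induction with
    | zero => simpa using hz
    | step z i hi h ih =>
      intro a c
      rw [h1 x y z a c i hi h, ih, ih, Nat.size_two_mul_add hi h, ← add_assoc, pow_succ,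
        mul_two, rev_add, pow_add]
      ring
  intro x y
  suffices hz : ∀ a c, R x y 0 a c =
      c * 2 ^ 2 ^ (Nat.size x * Nat.size y) + rev (2 ^ (Nat.size x * Nat.size y)) a by
    exact of_zero x y hz
  induction y using Nat.binary_induction with
  | zero =>
    induction x using Nat.binary_induction with
    | zero => intro a c; simp [h0, rev, mul_comm]
    | step x i hi h ih => intro a c; simpa [h3 x a c i hi h] using ih a c
  | step y i hi h ih =>
    intro a c
    rw [h2 x y a c i hi h, of_zero x y ih x a c, Nat.size_two_mul_add hi h, mul_add_one]
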